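/- arXiv:1809.03013 — 5 statements merged into one kernel-verified Lean document; each statement's English description precedes it below -/
import Mathlib

section
/- Let 1 ≤ p < ∞, w ∈ 𝒲, and 1 < t < ∞. Given finite tuples f₁ ∈ ℝ^n and f₂ ∈ ℝ^m with ‖f₁‖_g < t, and given any k₀ ∈ ℕ, there exist an integer k ≥ k₀ and a real α > 0 such that the constant k-tuple h = (α, …, α) satisfies ‖(h, f₁)‖_g < t and ‖(f₂, h)‖_g ≥ (‖f₂‖_g^p + 1)^{1/p}, where (h, f₁) and (f₂, h) denote concatenations of tuples. -/
open Filter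
open scoped ENNReal NNReal

noncomputable section

/-- The class `𝒲` of weights: `1 = w₁ ≥ w₂ ≥ ⋯ > 0`, `w_j → 0`, `∑ w_j = ∞`.
(`0`-indexed: `w 0` plays the role of `w₁`.) -/
def IsGarlingWeight (w : ℕ → ℝ) : Prop :=
  w 0 = 1 ∧ (∀ n, 0 < w n) ∧ (∀ n, w (n + 1) ≤ w n) ∧
    Tendsto w atTop (nhds 0) ∧ ¬ Summable w

/-- The Garling norm `‖f‖_g = sup_φ (∑_j |a_{φ(j)}|^p w_j)^{1/p}`, the supremum over all
strictly increasing `φ : ℕ → ℕ`, with values in `ℝ≥0∞`. -/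
noncomputable def garlingNorm (p : ℝ) (w : ℕ → ℝ) (f : ℕ → ℝ) : ℝ≥0∞ :=
  ⨆ φ : {φ : ℕ → ℕ // StrictMono φ},
    (∑' j : ℕ, ENNReal.ofReal (|f (φ.1 j)| ^ p * w j)) ^ (1 / p)

/-- Extension of a finite tuple by zeros. -/
def extendTuple {k : ℕ} (f : Fin k → ℝ) : ℕ → ℝ :=
  fun j => if h : j < k then f ⟨j, h⟩ else 0

/-- The `p`-th power of the Garling norm. -/
def garlingPow (p : ℝ) (w f : ℕ → ℝ) : ℝ≥0∞ :=
  ⨆ φ : {φ : ℕ → ℕ // StrictMono φ}, ∑' j : ℕ, ENNReal.ofReal (|f (φ.1 j)| ^ p * w j)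

lemma garlingNorm_eq_garlingPow_rpow {p : ℝ} (hp : 0 < p) (w f : ℕ → ℝ) :
    garlingNorm p w f = garlingPow p w f ^ (1 / p) :=
  ((ENNReal.orderIsoRpow (1 / p) (by positivity)).map_iSup _).symm

lemma garlingNorm_rpow {p : ℝ} (hp : 0 < p) (w f : ℕ → ℝ) :
    garlingNorm p w f ^ p = garlingPow p w f := by
  rw [garlingNorm_eq_garlingPow_rpow hp, ← ENNReal.rpow_mul, one_div_mul_cancel hp.ne',
    ENNReal.rpow_one]

lemma garlingNorm_lt_ofReal_iff {p : ℝ} (hp : 0 < p) (w f : ℕ → ℝ) {t : ℝ} (ht : 0 < t) :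
    garlingNorm p w f < ENNReal.ofReal t ↔ garlingPow p w f < ENNReal.ofReal (t ^ p) := by
  rw [← ENNReal.rpow_lt_rpow_iff hp, garlingNorm_rpow hp, ENNReal.ofReal_rpow_of_pos ht]

lemma le_garlingPow (p : ℝ) (w f : ℕ → ℝ) {φ : ℕ → ℕ} (hφ : StrictMono φ) :
    ∑' j : ℕ, ENNReal.ofReal (|f (φ j)| ^ p * w j) ≤ garlingPow p w f :=
  le_iSup (fun φ : {φ : ℕ → ℕ // StrictMono φ} =>
    ∑' j : ℕ, ENNReal.ofReal (|f (φ.1 j)| ^ p * w j)) ⟨φ, hφ⟩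

lemma StrictMono.exists_forall_lt_iff_lt {φ : ℕ → ℕ} (hφ : StrictMono φ) (k : ℕ) :
    ∃ s ≤ k, ∀ j, φ j < k ↔ j < s := by
  have h : ∃ j, k ≤ φ j := ⟨k, hφ.le_apply⟩
  refine ⟨Nat.find h, Nat.find_min' h hφ.le_apply, fun j => ⟨fun hj => ?_, fun hj => ?_⟩⟩
  · by_contra! hc
    exact absurd (hφ.monotone hc) (not_le.2 (hj.trans_le (Nat.find_spec h)))
  · exact not_le.1 (Nat.find_min h hj)

lemma extendTuple_of_le {k : ℕ} (f : Fin k → ℝ) {j : ℕ} (hj : k ≤ j) : extendTuple f j = 0 :=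
  dif_neg hj.not_gt

lemma extendTuple_append_of_lt {m k : ℕ} (f : Fin m → ℝ) (g : Fin k → ℝ) {j : ℕ} (hj : j < m) :
    extendTuple (Fin.append f g) j = extendTuple f j := by
  unfold extendTuple
  rw [dif_pos (by omega), dif_pos hj]
  exact Fin.append_left f g ⟨j, hj⟩

lemma extendTuple_append_add {m k : ℕ} (f : Fin m → ℝ) (g : Fin k → ℝ) (j : ℕ) :
    extendTuple (Fin.append f g) (m + j) = extendTuple g j := by
  unfold extendTuple
  by_cases hj : j < k
  · rw [dif_pos (by omega), dif_pos hj]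
    exact Fin.append_right f g ⟨j, hj⟩
  · rw [dif_neg (by omega), dif_neg hj]

lemma extendTuple_const_of_lt {k : ℕ} (α : ℝ) {j : ℕ} (hj : j < k) :
    extendTuple (fun _ : Fin k => α) j = α :=
  dif_pos hj

lemma tsum_extendTuple_rpow_ne_top {p : ℝ} (hp : 0 < p) {n : ℕ} (f : Fin n → ℝ) :
    ∑' j, ENNReal.ofReal (|extendTuple f j| ^ p) ≠ ∞ := by
  rw [tsum_eq_sum (s := Finset.range n)]
  · exact (ENNReal.sum_lt_top.2 fun _ _ => ENNReal.ofReal_lt_top).ne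
  · intro j hj
    rw [extendTuple_of_le f (by simpa using hj), abs_zero, Real.zero_rpow hp.ne',
      ENNReal.ofReal_zero]

lemma sum_range_ofReal_const_mul {w : ℕ → ℝ} (hw : ∀ j, 0 ≤ w j) {c : ℝ} (hc : 0 ≤ c) (s : ℕ) :
    ∑ j ∈ Finset.range s, ENNReal.ofReal (c * w j) =
      ENNReal.ofReal (c * ∑ j ∈ Finset.range s, w j) := by
  rw [Finset.mul_sum, ENNReal.ofReal_sum_of_nonneg fun j _ => mul_nonneg hc (hw j)]

/-- Splitting off the constant block of `(h, f)`: what remains of the sum is controlled both by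
the Garling norm of `f` and by its `ℓ_p` norm times the first weight not used by the block. -/
lemma exists_tsum_append_const_le {p : ℝ} {w : ℕ → ℝ} (hw : ∀ j, 0 ≤ w j)
    (hanti : Antitone w) {k n : ℕ} {α : ℝ} (hα : 0 ≤ α) (f : Fin n → ℝ) {φ : ℕ → ℕ}
    (hφ : StrictMono φ) :
    ∃ s ≤ k,
      ∑' j, ENNReal.ofReal
        (|extendTuple (Fin.append (fun _ : Fin k => α) f) (φ j)| ^ p * w j) ≤
        ENNReal.ofReal (α ^ p * ∑ j ∈ Finset.range s, w j) +
          min (garlingPow p w (extendTuple f))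
            (ENNReal.ofReal (w s) * ∑' j, ENNReal.ofReal (|extendTuple f j| ^ p)) := by
  obtain ⟨s, hsk, hs⟩ := hφ.exists_forall_lt_iff_lt k
  refine ⟨s, hsk, ?_⟩
  have hle (i : ℕ) : k ≤ φ (i + s) := not_lt.1 fun h => by have := (hs _).1 h; omega
  set ψ : ℕ → ℕ := fun i => φ (i + s) - k with hψ
  have hψ_mono : StrictMono ψ := fun a b hab => by
    have h1 : φ (a + s) < φ (b + s) := hφ (by omega)
    have h2 := hle a
    simp only [hψ]
    omega
  have hφψ (i : ℕ) : φ (i + s) = k + ψ i := by have := hle i; simp only [hψ]; omega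
  rw [← Summable.sum_add_tsum_nat_add' (k := s) ENNReal.summable,
    ← sum_range_ofReal_const_mul hw (by positivity)]
  refine add_le_add (Finset.sum_le_sum fun j hj => ?_) ?_
  · have hj' := (hs j).2 (Finset.mem_range.1 hj)
    rw [extendTuple_append_of_lt _ _ hj', extendTuple_const_of_lt α hj', abs_of_nonneg hα]
  · simp only [hφψ, extendTuple_append_add]
    refine le_min ((ENNReal.tsum_le_tsum fun i => ?_).trans (le_garlingPow p w _ hψ_mono)) ?_
    · gcongr
      exact hanti (Nat.le_add_right i s)
    · rw [← ENNReal.tsum_mul_left]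
      refine le_trans (ENNReal.tsum_le_tsum fun i => ?_)
        (ENNReal.tsum_comp_le_tsum_of_injective hψ_mono.injective
          fun j => ENNReal.ofReal (w s) * ENNReal.ofReal (|extendTuple f j| ^ p))
      rw [mul_comm, ENNReal.ofReal_mul (hw _)]
      gcongr
      exact hanti (Nat.le_add_left s i)

lemma garlingPow_append_const_le {p : ℝ} {w : ℕ → ℝ} (hw : ∀ j, 0 ≤ w j)
    (hanti : Antitone w) {k n : ℕ} {α : ℝ} (hα : 0 ≤ α) (f : Fin n → ℝ) (S : ℕ) :
    garlingPow p w (extendTuple (Fin.append (fun _ : Fin k => α) f)) ≤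
      max (ENNReal.ofReal (α ^ p * ∑ j ∈ Finset.range S, w j) + garlingPow p w (extendTuple f))
        (ENNReal.ofReal (α ^ p * ∑ j ∈ Finset.range k, w j) +
          ENNReal.ofReal (w S) * ∑' j, ENNReal.ofReal (|extendTuple f j| ^ p)) := by
  refine iSup_le fun φ => ?_
  obtain ⟨s, hsk, hs⟩ := exists_tsum_append_const_le (p := p) (k := k) hw hanti hα f φ.2
  have hsum {a b : ℕ} (hab : a ≤ b) : ENNReal.ofReal (α ^ p * ∑ j ∈ Finset.range a, w j) ≤
      ENNReal.ofReal (α ^ p * ∑ j ∈ Finset.range b, w j) := by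
    gcongr
    exact fun j _ _ => hw j
  refine hs.trans ?_
  rcases le_total s S with h | h
  · exact le_max_of_le_left (add_le_add (hsum h) (min_le_left _ _))
  · refine le_max_of_le_right (add_le_add (hsum hsk) ((min_le_right _ _).trans ?_))
    gcongr
    exact hanti h

lemma garlingPow_add_le_append_const {p : ℝ} (hp : 0 < p) {w : ℕ → ℝ} (hw : ∀ j, 0 ≤ w j)
    (hanti : Antitone w) {k m : ℕ} {α : ℝ} (hα : 0 ≤ α) (f : Fin m → ℝ) :
    garlingPow p w (extendTuple f) +
        ENNReal.ofReal (α ^ p * ∑ j ∈ Finset.range k, w (m + j)) ≤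
      garlingPow p w (extendTuple (Fin.append f (fun _ : Fin k => α))) := by
  have : Nonempty {φ : ℕ → ℕ // StrictMono φ} := ⟨⟨id, strictMono_id⟩⟩
  rw [garlingPow, ENNReal.iSup_add]
  refine iSup_le fun ⟨φ, hφ⟩ => ?_
  obtain ⟨s, hsm, hs⟩ := hφ.exists_forall_lt_iff_lt m
  set ψ : ℕ → ℕ := fun j => if j < s then φ j else m + (j - s) with hψ
  have hψ_mono : StrictMono ψ := fun a b hab => by
    have h1 := hφ hab
    have h2 := hs a
    simp only [hψ]
    split_ifs <;> grind
  refine le_trans ?_ (le_garlingPow p w _ hψ_mono)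
  rw [← Summable.sum_add_tsum_nat_add' (k := s) ENNReal.summable,
    ← Summable.sum_add_tsum_nat_add' (k := s)
      (f := fun j => ENNReal.ofReal (|extendTuple (Fin.append f _) (ψ j)| ^ p * w j))
      ENNReal.summable]
  have htail : ∑' i, ENNReal.ofReal (|extendTuple f (φ (i + s))| ^ p * w (i + s)) = 0 := by
    refine ENNReal.tsum_eq_zero.2 fun i => ?_
    have hle : m ≤ φ (i + s) := not_lt.1 fun h => by have := (hs _).1 h; omega
    rw [extendTuple_of_le f hle, abs_zero, Real.zero_rpow hp.ne', zero_mul, ENNReal.ofReal_zero]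
  rw [htail, add_zero]
  refine add_le_add (Finset.sum_le_sum fun j hj => ?_) ?_
  · have hj' := Finset.mem_range.1 hj
    simp only [hψ, if_pos hj']
    rw [extendTuple_append_of_lt _ _ ((hs j).2 hj')]
  · rw [← sum_range_ofReal_const_mul (w := fun j => w (m + j)) (fun j => hw _) (by positivity)]
    refine le_trans (Finset.sum_le_sum fun j hj => ?_) (ENNReal.sum_le_tsum (Finset.range k))
    have hψj : ψ (j + s) = m + j := by simp [hψ]
    rw [hψj, extendTuple_append_add, extendTuple_const_of_lt α (Finset.mem_range.1 hj),
      abs_of_nonneg hα]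
    gcongr
    exact hanti (by omega)

/-- **Lemma 1 (gliding hump).** Given `1 ≤ p < ∞`, `w ∈ 𝒲`, `1 < t < ∞`, finite tuples
`f₁`, `f₂` with `‖f₁‖_g < t`, and any `k₀`, there are `k ≥ k₀` and `α > 0` such that the
constant `k`-tuple `h = (α,…,α)` satisfies `‖(h,f₁)‖_g < t` and
`‖(f₂,h)‖_g ≥ (‖f₂‖_g^p + 1)^(1/p)`. -/
theorem garling_gliding_hump (p : ℝ) (hp : 1 ≤ p) (w : ℕ → ℝ) (hw : IsGarlingWeight w)
    (t : ℝ) (ht : 1 < t) {n m : ℕ} (f₁ : Fin n → ℝ) (f₂ : Fin m → ℝ)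
    (hf₁ : garlingNorm p w (extendTuple f₁) < ENNReal.ofReal t) (k₀ : ℕ) :
    ∃ k ≥ k₀, ∃ α : ℝ, 0 < α ∧
      garlingNorm p w (extendTuple (Fin.append (fun _ : Fin k => α) f₁)) <
        ENNReal.ofReal t ∧
      (garlingNorm p w (extendTuple f₂) ^ p + 1) ^ (1 / p) ≤
        garlingNorm p w (extendTuple (Fin.append f₂ (fun _ : Fin k => α))) := by
  obtain ⟨-, hpos, hstep, hlim, hsum⟩ := hw
  have hp0 : 0 < p := by linarith
  have hw0 (j : ℕ) : 0 ≤ w j := (hpos j).le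
  have hanti : Antitone w := antitone_nat_of_succ_le hstep
  rw [garlingNorm_lt_ofReal_iff hp0 _ _ (by linarith)] at hf₁
  have htp : 1 < t ^ p := Real.one_lt_rpow ht hp0
  obtain ⟨N, hN0, hN⟩ : ∃ N : ℝ, 0 ≤ N ∧ garlingPow p w (extendTuple f₁) = ENNReal.ofReal N :=
    ⟨_, ENNReal.toReal_nonneg, (ENNReal.ofReal_toReal hf₁.ne_top).symm⟩
  obtain ⟨C, hC0, hC⟩ : ∃ C : ℝ, 0 ≤ C ∧
      ∑' j, ENNReal.ofReal (|extendTuple f₁ j| ^ p) = ENNReal.ofReal C :=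
    ⟨_, ENNReal.toReal_nonneg,
      (ENNReal.ofReal_toReal (tsum_extendTuple_rpow_ne_top hp0 f₁)).symm⟩
  have hNt : N < t ^ p := by
    rw [hN] at hf₁
    exact (ENNReal.ofReal_lt_ofReal_iff (by linarith)).1 hf₁
  set W : ℕ → ℝ := fun k => ∑ j ∈ Finset.range k, w j with hW
  obtain ⟨S, hS⟩ : ∃ S, w S * C < (t ^ p - 1) / 2 := by
    have h : Tendsto (fun S => w S * C) atTop (nhds 0) := by simpa using hlim.mul_const C
    exact (h.eventually_lt_const (by linarith)).exists
  have hW_top : Tendsto (fun k => ∑ j ∈ Finset.range k, w (m + j)) atTop atTop := by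
    refine (not_summable_iff_tendsto_nat_atTop_of_nonneg fun j => hw0 (m + j)).1 fun h => hsum ?_
    exact (summable_nat_add_iff m).1 (by simpa only [add_comm] using h)
  have hinv := tendsto_inv_atTop_zero.comp hW_top
  have hlim_mul (c : ℝ) : Tendsto (fun k => (∑ j ∈ Finset.range k, w (m + j))⁻¹ * c)
      atTop (nhds 0) := by simpa using hinv.mul_const c
  obtain ⟨k, hkm, hkS, hk, hk0⟩ := (((hlim_mul (W m)).eventually_lt_const
    (show 0 < (t ^ p - 1) / 2 by linarith)).and (((hlim_mul (W S)).eventually_lt_const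
    (show 0 < t ^ p - N by linarith)).and ((eventually_ge_atTop k₀).and
      (hW_top.eventually_gt_atTop 0)))).exists
  set D := ∑ j ∈ Finset.range k, w (m + j) with hD
  have hα : (D⁻¹ ^ (1 / p)) ^ p = D⁻¹ := by
    rw [← Real.rpow_mul (by positivity), one_div_mul_cancel hp0.ne', Real.rpow_one]
  have hα0 : 0 < D⁻¹ ^ (1 / p) := by positivity
  refine ⟨k, hk, D⁻¹ ^ (1 / p), hα0, ?_, ?_⟩
  · rw [garlingNorm_lt_ofReal_iff hp0 _ _ (by linarith)]
    refine (garlingPow_append_const_le hw0 hanti hα0.le f₁ S).trans_lt ?_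
    have hWnonneg (i : ℕ) : 0 ≤ W i := Finset.sum_nonneg fun j _ => hw0 j
    have hWk : D⁻¹ * W k ≤ 1 + D⁻¹ * W m := by
      have hle : W k ≤ W m + D := by
        rw [hD, hW, ← Finset.sum_range_add]
        exact Finset.sum_le_sum_of_subset_of_nonneg (Finset.range_mono (by omega))
          fun j _ _ => hw0 j
      calc D⁻¹ * W k ≤ D⁻¹ * (W m + D) := by gcongr
        _ = 1 + D⁻¹ * W m := by field_simp; ring
    have hinv0 : 0 ≤ D⁻¹ := by positivity
    rw [hα, hN, hC, ← ENNReal.ofReal_mul (hw0 S),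
      ← ENNReal.ofReal_add (mul_nonneg hinv0 (hWnonneg S)) hN0,
      ← ENNReal.ofReal_add (mul_nonneg hinv0 (hWnonneg k)) (mul_nonneg (hw0 S) hC0)]
    refine max_lt ?_ ?_ <;> rw [ENNReal.ofReal_lt_ofReal_iff (by linarith)]
    · change D⁻¹ * W S + N < t ^ p
      linarith
    · change D⁻¹ * W k + w S * C < t ^ p
      linarith
  · rw [garlingNorm_rpow hp0, garlingNorm_eq_garlingPow_rpow hp0]
    gcongr
    have h := garlingPow_add_le_append_const hp0 hw0 hanti (k := k) hα0.le f₂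
    rwa [hα, inv_mul_cancel₀ hk0.ne', ENNReal.ofReal_one] at h

end
end

section
/- Let 1 ≤ p < ∞, w ∈ 𝒲, and t ∈ (0, ∞). Let (y_n)_{n=1}^∞ be a block basic sequence of the unit vector system of g(w,p), i.e., a sequence of nonzero finitely supported sequences whose supports are consecutive (max supp(y_n) < min supp(y_{n+1}) for all n), such that ‖y_n‖_g ≤ t for every n. Then for every finitely supported scalar sequence (a_n), one has ‖∑_{n=1}^∞ a_n y_n‖_g ≤ t (∑_{n=1}^∞ |a_n|^p)^{1/p}. -/
open Filter
open scoped ENNReal NNReal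

noncomputable section

/-- Supports of a block sequence are increasing, not only for consecutive indices. -/
theorem block_support_lt {y : ℕ → ℕ → ℝ} (hne : ∀ n, y n ≠ 0)
    (hblock : ∀ n, ∀ i ∈ Function.support (y n), ∀ j ∈ Function.support (y (n + 1)), i < j)
    {m n : ℕ} (hmn : m < n) :
    ∀ i ∈ Function.support (y m), ∀ j ∈ Function.support (y n), i < j := by
  induction n, hmn using Nat.le_induction with
  | base => exact hblock m
  | succ n _ ih =>
    intro i hi j hj
    obtain ⟨l, hl⟩ := Function.support_nonempty_iff.mpr (hne n)
    exact (ih i hi l hl).trans (hblock n l hl j hj)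

/-- A block sequence has at most one term that is nonzero at a given coordinate. -/
theorem exists_block_forall_ne_eq_zero {y : ℕ → ℕ → ℝ} (hne : ∀ n, y n ≠ 0)
    (hblock : ∀ n, ∀ i ∈ Function.support (y n), ∀ j ∈ Function.support (y (n + 1)), i < j)
    (i : ℕ) : ∃ m, ∀ n, n ≠ m → y n i = 0 := by
  by_cases h : ∃ m, y m i ≠ 0
  · obtain ⟨m, hm⟩ := h
    refine ⟨m, fun n hnm => by_contra fun hn => ?_⟩
    rcases hnm.lt_or_gt with hlt | hlt
    · exact lt_irrefl i (block_support_lt hne hblock hlt i hn i hm)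
    · exact lt_irrefl i (block_support_lt hne hblock hlt i hm i hn)
  · push Not at h
    exact ⟨0, fun n _ => h n⟩

/-- Each weighted `p`-sum along a strictly increasing `φ` is at most the `p`-th power of a bound
for the Garling norm. -/
theorem tsum_le_rpow_of_garlingNorm_le {p : ℝ} (hp : 0 < p) {w f : ℕ → ℝ} {C : ℝ≥0∞}
    (h : garlingNorm p w f ≤ C) {φ : ℕ → ℕ} (hφ : StrictMono φ) :
    ∑' j : ℕ, ENNReal.ofReal (|f (φ j)| ^ p * w j) ≤ C ^ p := by
  have hφC := (iSup_le_iff.mp h) ⟨φ, hφ⟩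
  rwa [one_div, ENNReal.rpow_inv_le_iff hp] at hφC

/-- **Proposition `lpdominates`.** If `(y_n)` is a block basic sequence of the unit vector
system of `g(w,p)` (nonzero, finitely supported, with consecutive supports) and
`‖y_n‖_g ≤ t` for all `n`, then for every finitely supported scalar sequence `(a_n)`,
`‖∑_n a_n y_n‖_g ≤ t (∑_n |a_n|^p)^{1/p}`. -/
theorem garling_block_sequence_dominated_by_lp (p : ℝ) (hp : 1 ≤ p) (w : ℕ → ℝ)
    (hw : IsGarlingWeight w) (t : ℝ) (ht : 0 < t)
    (y : ℕ → ℕ → ℝ)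
    (hfin : ∀ n, (Function.support (y n)).Finite)
    (hne : ∀ n, y n ≠ 0)
    (hblock : ∀ n, ∀ i ∈ Function.support (y n), ∀ j ∈ Function.support (y (n + 1)), i < j)
    (hnorm : ∀ n, garlingNorm p w (y n) ≤ ENNReal.ofReal t)
    (a : ℕ → ℝ) (ha : (Function.support a).Finite) :
    garlingNorm p w (fun i => ∑ᶠ n, a n * y n i) ≤
      ENNReal.ofReal t * (∑' n : ℕ, ENNReal.ofReal (|a n| ^ p)) ^ (1 / p) := by
  have hp0 : 0 < p := zero_lt_one.trans_le hp
  refine iSup_le fun ⟨φ, hφ⟩ => ?_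
  have hterm : ∀ j, ENNReal.ofReal (|∑ᶠ n, a n * y n (φ j)| ^ p * w j) ≤
      ∑' n, ENNReal.ofReal (|a n| ^ p) * ENNReal.ofReal (|y n (φ j)| ^ p * w j) := by
    intro j
    obtain ⟨m, hm⟩ := exists_block_forall_ne_eq_zero hne hblock (φ j)
    rw [finsum_eq_single _ m fun n hn => by rw [hm n hn, mul_zero], abs_mul,
      Real.mul_rpow (abs_nonneg _) (abs_nonneg _), mul_assoc, ENNReal.ofReal_mul (by positivity)]
    exact ENNReal.le_tsum m
  have hsum : ∑' j, ENNReal.ofReal (|∑ᶠ n, a n * y n (φ j)| ^ p * w j) ≤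
      ENNReal.ofReal t ^ p * ∑' n, ENNReal.ofReal (|a n| ^ p) := by
    refine (ENNReal.tsum_le_tsum hterm).trans ?_
    rw [ENNReal.tsum_comm, mul_comm, ← ENNReal.tsum_mul_right]
    refine ENNReal.tsum_le_tsum fun n => ?_
    rw [ENNReal.tsum_mul_left]
    gcongr
    exact tsum_le_rpow_of_garlingNorm_le hp0 (hnorm n) hφ
  refine (ENNReal.rpow_le_rpow hsum (by positivity)).trans_eq ?_
  rw [ENNReal.mul_rpow_of_nonneg _ _ (by positivity), one_div, ENNReal.rpow_rpow_inv hp0.ne']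

end
end

section
/- Let 1 ≤ p < ∞ and w ∈ 𝒲. For each ε > 0 there exist bounded linear operators S : (⊕_{n=1}^∞ ℓ_∞^n)_p → g(w,p) and P : g(w,p) → (⊕_{n=1}^∞ ℓ_∞^n)_p such that P ∘ S is the identity on (⊕_{n=1}^∞ ℓ_∞^n)_p, ‖S‖ ≤ (1+ε)^{1/2}, ‖P‖ ≤ (1+ε)^{1/2}, and S carries the unit vectors of (⊕_{n=1}^∞ ℓ_∞^n)_p to nonnegative, pairwise disjointly supported vectors of g(w,p) (so that the range of S is a sublattice of g(w,p) which is (1+ε)-lattice isomorphic to (⊕_{n=1}^∞ ℓ_∞^n)_p and (1+ε)-complemented in g(w,p)). -/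
open Filter
open scoped ENNReal NNReal

noncomputable section

/-- The norm of the mixed-norm space `(⊕_{n=1}^∞ ℓ_∞^n)_p`: elements are sequences
`x` with `x n ∈ ℝ^{n+1}` (so blocks have dimensions `1, 2, 3, …`), with norm
`(∑_n ‖x n‖_∞^p)^{1/p}`, valued in `ℝ≥0∞`. -/
noncomputable def besovNorm (p : ℝ) (x : (n : ℕ) → Fin (n + 1) → ℝ) : ℝ≥0∞ :=
  (∑' n : ℕ, (⨆ i : Fin (n + 1), ENNReal.ofReal |x n i|) ^ p) ^ (1 / p)

/-- The unit vectors of `(⊕_{n=1}^∞ ℓ_∞^n)_p`. -/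
def besovUnit (n : ℕ) (i : Fin (n + 1)) : (m : ℕ) → Fin (m + 1) → ℝ :=
  fun m j => if m = n ∧ (j : ℕ) = (i : ℕ) then 1 else 0

/-- The weighted sum `∑_j U (φ j) w_j` of a nonnegative sequence `U` along `φ`. -/
def garlingSum (w : ℕ → ℝ) (φ : ℕ → ℕ) (U : ℕ → ℝ≥0∞) : ℝ≥0∞ :=
  ∑' j, U (φ j) * ENNReal.ofReal (w j)

theorem StrictMono.exists_first_ge {φ : ℕ → ℕ} (hφ : StrictMono φ) (N : ℕ) :
    ∃ k ≤ N, (∀ j < k, φ j < N) ∧ ∀ j, N ≤ φ (j + k) := by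
  classical
  have h : ∃ k, N ≤ φ k := ⟨N, hφ.le_apply⟩
  refine ⟨Nat.find h, Nat.find_min' h hφ.le_apply, fun j hj => ?_, fun j => ?_⟩
  · exact not_le.1 (Nat.find_min h hj)
  · exact (Nat.find_spec h).trans (hφ.monotone (Nat.le_add_left _ _))

theorem StrictMono.shift_sub {φ : ℕ → ℕ} (hφ : StrictMono φ) {N k : ℕ}
    (hk : ∀ j, N ≤ φ (j + k)) : StrictMono fun j => φ (j + k) - N := by
  intro a b hab
  have h1 := hφ (Nat.add_lt_add_right hab k)
  have h2 := hk a
  dsimp only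
  omega

theorem garlingSum_split (w : ℕ → ℝ) (φ : ℕ → ℕ) (U : ℕ → ℝ≥0∞) (k : ℕ) :
    garlingSum w φ U = ∑ j ∈ Finset.range k, U (φ j) * ENNReal.ofReal (w j) +
      ∑' j, U (φ (j + k)) * ENNReal.ofReal (w (j + k)) :=
  (Summable.sum_add_tsum_nat_add' (f := fun j => U (φ j) * ENNReal.ofReal (w j)) (k := k)
    ENNReal.summable).symm

theorem garlingSum_shift_le {w : ℕ → ℝ} (hw : Antitone w) {U : ℕ → ℝ≥0∞} {C : ℝ≥0∞}
    (hU : ∀ φ, StrictMono φ → garlingSum w φ U ≤ C) (M : ℕ) {φ : ℕ → ℕ} (hφ : StrictMono φ) :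
    garlingSum w φ (fun a => if M ≤ a then U (a - M) else 0) ≤ C := by
  obtain ⟨k, -, hlt, hge⟩ := hφ.exists_first_ge M
  rw [garlingSum_split w φ _ k, Finset.sum_eq_zero, zero_add]
  · refine le_trans (ENNReal.tsum_le_tsum fun j => ?_) (hU _ (hφ.shift_sub hge))
    rw [if_pos (hge j)]
    gcongr
    exact hw (Nat.le_add_right _ _)
  · intro j hj
    rw [if_neg (hlt j (Finset.mem_range.1 hj)).not_ge, zero_mul]

theorem IsGarlingWeight.antitone {w : ℕ → ℝ} (hw : IsGarlingWeight w) : Antitone w :=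
  antitone_nat_of_succ_le hw.2.2.1

theorem IsGarlingWeight.tendsto_sum_atTop {w : ℕ → ℝ} (hw : IsGarlingWeight w) (M : ℕ) :
    Tendsto (fun N => ∑ k ∈ Finset.range N, w (M + k)) atTop atTop := by
  refine (not_summable_iff_tendsto_nat_atTop_of_nonneg fun k => (hw.2.1 _).le).1 fun h => ?_
  exact hw.2.2.2.2 ((summable_nat_add_iff M).1 (by simpa only [add_comm] using h))

/-- Prepending a sufficiently long flat block to `U` costs at most `δ` in the Garling norm. -/
theorem exists_prepend_block {w : ℕ → ℝ} (hw : IsGarlingWeight w) (M : ℕ) {δ : ℝ} (hδ : 0 < δ)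
    {U : ℕ → ℝ≥0∞} (hfin : ∑' a, U a ≠ ∞)
    (hU : ∀ φ, StrictMono φ → garlingSum w φ U ≤ ENNReal.ofReal (1 + δ)) :
    ∃ N : ℕ, 0 < N ∧ ∀ φ, StrictMono φ →
      garlingSum w φ (fun a => if a < N then
        ENNReal.ofReal (1 / ∑ k ∈ Finset.range N, w (M + k)) else U (a - N)) ≤
      ENNReal.ofReal (1 + (δ + δ)) := by
  obtain ⟨K, hK⟩ : ∃ K, ENNReal.ofReal (w K) * ∑' a, U a ≤ ENNReal.ofReal δ := by
    have h1 : Tendsto (fun K => ENNReal.ofReal (w K * (∑' a, U a).toReal)) atTop (nhds 0) := by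
      have := ENNReal.tendsto_ofReal (hw.2.2.2.1.mul_const (∑' a, U a).toReal)
      simpa using this
    obtain ⟨K, hK⟩ := (h1.eventually (gt_mem_nhds (ENNReal.ofReal_pos.2 hδ))).exists
    refine ⟨K, ?_⟩
    rw [ENNReal.ofReal_mul (hw.2.1 K).le, ENNReal.ofReal_toReal hfin] at hK
    exact hK.le
  obtain ⟨N, hN⟩ := (((hw.tendsto_sum_atTop M).eventually_ge_atTop
    ((∑ k ∈ Finset.range M, w k) / δ)).and
    (((hw.tendsto_sum_atTop M).eventually_ge_atTop
    ((∑ k ∈ Finset.range K, w k) / δ)).and (eventually_gt_atTop 0))).exists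
  obtain ⟨hM, hKN, hN0⟩ := hN
  refine ⟨N, hN0, fun φ hφ => ?_⟩
  set V := ∑ k ∈ Finset.range N, w (M + k) with hV
  have hVpos : 0 < V := Finset.sum_pos (fun _ _ => hw.2.1 _) ⟨0, Finset.mem_range.2 hN0⟩
  rw [div_le_iff₀ hδ] at hM hKN
  have hmono : ∀ {a b : ℕ}, a ≤ b →
      ∑ k ∈ Finset.range a, w k ≤ ∑ k ∈ Finset.range b, w k := fun h =>
    Finset.sum_le_sum_of_subset_of_nonneg (Finset.range_mono h) fun _ _ _ => (hw.2.1 _).le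
  have hWN : ∑ k ∈ Finset.range N, w k ≤ V * (1 + δ) := by
    have := hmono (Nat.le_add_left N M)
    rw [Finset.sum_range_add] at this
    linarith
  obtain ⟨k, hkN, hlt, hge⟩ := hφ.exists_first_ge N
  have hhead : ∑ j ∈ Finset.range k, (if φ j < N then ENNReal.ofReal (1 / V)
      else U (φ j - N)) * ENNReal.ofReal (w j) =
      ENNReal.ofReal ((∑ j ∈ Finset.range k, w j) / V) := by
    rw [Finset.sum_div, ENNReal.ofReal_sum_of_nonneg
      fun j _ => div_nonneg (hw.2.1 j).le hVpos.le]
    refine Finset.sum_congr rfl fun j hj => ?_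
    rw [if_pos (hlt j (Finset.mem_range.1 hj)), ← ENNReal.ofReal_mul (by positivity)]
    congr 1
    ring
  have htail : ∀ j, (if φ (j + k) < N then ENNReal.ofReal (1 / V) else U (φ (j + k) - N)) =
      U (φ (j + k) - N) := fun j => if_neg (hge j).not_gt
  rw [garlingSum_split w φ _ k, hhead]
  simp only [htail]
  have hψ := hφ.shift_sub hge
  rcases lt_or_ge k K with hk | hk
  · rw [show 1 + (δ + δ) = δ + (1 + δ) by ring, ENNReal.ofReal_add hδ.le (by positivity)]
    refine add_le_add (ENNReal.ofReal_le_ofReal ?_) (le_trans (ENNReal.tsum_le_tsum fun j => ?_)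
      (hU _ hψ))
    · rw [div_le_iff₀ hVpos]
      linarith [hmono hk.le]
    · gcongr
      exact hw.antitone (Nat.le_add_right _ _)
  · rw [← add_assoc, ENNReal.ofReal_add (by positivity) hδ.le]
    refine add_le_add (ENNReal.ofReal_le_ofReal ?_) (le_trans ?_ hK)
    · rw [div_le_iff₀ hVpos]
      linarith [hmono hkN]
    · rw [mul_comm]
      refine le_trans (ENNReal.tsum_le_tsum (g := fun j =>
        U (φ (j + k) - N) * ENNReal.ofReal (w K)) fun j => ?_) ?_
      · gcongr
        exact hw.antitone (by omega)
      · rw [ENNReal.tsum_mul_right]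
        exact mul_le_mul' (ENNReal.tsum_comp_le_tsum_of_injective hψ.injective U) le_rfl

/-- For every `m` there are `m` flat blocks, placed one after the other, whose sum has Garling norm
at most `1 + δ`, although each is normalized by `∑_{k < N} w (M + k)`. -/
theorem exists_blocks {w : ℕ → ℝ} (hw : IsGarlingWeight w) (M m : ℕ) {δ : ℝ} (hδ : 0 < δ) :
    ∃ (N c : Fin m → ℕ) (l : ℕ) (U : ℕ → ℝ≥0∞), ∑' a, U a ≠ ∞ ∧ (∀ i, 0 < N i) ∧
      (∀ i, c i + N i ≤ l) ∧ (∀ i i', i < i' → c i + N i ≤ c i') ∧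
      (∀ i, ∀ j < N i, U (c i + j) =
        ENNReal.ofReal (1 / ∑ k ∈ Finset.range (N i), w (M + k))) ∧
      ∀ φ, StrictMono φ → garlingSum w φ U ≤ ENNReal.ofReal (1 + δ) := by
  induction m generalizing δ with
  | zero =>
    refine ⟨Fin.elim0, Fin.elim0, 0, 0, by simp, fun i => i.elim0, fun i => i.elim0,
      fun i => i.elim0, fun i => i.elim0, fun φ _ => by simp [garlingSum]⟩
  | succ m ih =>
    obtain ⟨N, c, l, U, hfin, hN, hl, hc, hval, hU⟩ := ih (half_pos hδ)
    obtain ⟨N₀, hN₀, hU'⟩ := exists_prepend_block hw M (half_pos hδ) hfin hU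
    rw [add_halves] at hU'
    refine ⟨Fin.cons N₀ N, Fin.cons 0 fun i => N₀ + c i, N₀ + l, _, ?_, ?_, ?_, ?_, ?_, hU'⟩
    · rw [← Summable.sum_add_tsum_nat_add' (k := N₀) ENNReal.summable]
      refine ENNReal.add_ne_top.2 ⟨ENNReal.sum_ne_top.2 fun j hj => ?_, ?_⟩
      · rw [if_pos (Finset.mem_range.1 hj)]
        exact ENNReal.ofReal_ne_top
      · simpa using hfin
    · exact Fin.cases hN₀ hN
    · refine Fin.cases (by simp) fun i => ?_
      have := hl i
      simp only [Fin.cons_succ]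
      omega
    · refine Fin.cases (Fin.cases (by simp) fun i' _ => by simp) fun i =>
        Fin.cases (by simp) fun i' hi => ?_
      have := hc i i' (Fin.succ_lt_succ_iff.1 hi)
      simp only [Fin.cons_succ]
      omega
    · refine Fin.cases (fun j hj => ?_) fun i j hj => ?_
      · simp only [Fin.cons_zero] at hj ⊢
        rw [zero_add, if_pos hj]
      · simp only [Fin.cons_succ] at hj ⊢
        rw [if_neg (by omega), ← hval i j hj]
        congr 1
        omega

/-- Consecutive groups of blocks, the `n`-th of `n + 1` blocks starting after `M n`. -/
theorem exists_block_system {w : ℕ → ℝ} (hw : IsGarlingWeight w) {δ : ℝ} (hδ : 0 < δ) :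
    ∃ (M : ℕ → ℕ) (N s : (n : ℕ) → Fin (n + 1) → ℕ) (U : ℕ → ℕ → ℝ≥0∞),
      (∀ n i, 0 < N n i) ∧ (∀ n i, M n ≤ s n i) ∧ (∀ n i, s n i + N n i ≤ M (n + 1)) ∧
      (∀ n i i', i < i' → s n i + N n i ≤ s n i') ∧
      (∀ n i, ∀ j < N n i, U n (s n i + j) =
        ENNReal.ofReal (1 / ∑ k ∈ Finset.range (N n i), w (M n + k))) ∧
      ∀ n φ, StrictMono φ → garlingSum w φ (U n) ≤ ENNReal.ofReal (1 + δ) := by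
  choose N c l U _ hN hl hc hval hU using fun M n => exists_blocks hw M (n + 1) hδ
  let M : ℕ → ℕ := fun n => Nat.rec (motive := fun _ => ℕ) 0 (fun n m => m + l m n) n
  refine ⟨M, fun n => N (M n) n, fun n i => M n + c (M n) n i,
    fun (n a : ℕ) => if M n ≤ a then U (M n) n (a - M n) else 0, fun n => hN _ n,
    fun n i => Nat.le_add_right _ _, fun n i => ?_, fun n i i' hi => ?_, fun n i j hj => ?_,
    fun n φ hφ => garlingSum_shift_le hw.antitone (hU _ n) _ hφ⟩
  · have := hl (M n) n i
    change M n + c (M n) n i + N (M n) n i ≤ M n + l (M n) n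
    omega
  · have := hc (M n) n i i' hi
    dsimp only
    omega
  · dsimp only at hj ⊢
    rw [if_pos (by omega), ← hval (M n) n i j hj]
    congr 1
    omega

theorem abs_weighted_mean_rpow_le {ι : Type*} (t : Finset ι) {p : ℝ} (hp : 1 ≤ p) (w f : ι → ℝ)
    (hw : ∀ i, 0 ≤ w i) (hV : 0 < ∑ i ∈ t, w i) :
    |(∑ i ∈ t, w i) ^ (-(1 - p⁻¹)) * ∑ i ∈ t, w i * f i| ^ p ≤ ∑ i ∈ t, w i * |f i| ^ p := by
  have hp0 : 0 < p := by linarith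
  have hnn : 0 ≤ ∑ i ∈ t, w i * |f i| ^ p :=
    Finset.sum_nonneg fun i _ => mul_nonneg (hw i) (by positivity)
  have h1 : |∑ i ∈ t, w i * f i| ≤ ∑ i ∈ t, w i * |f i| := by
    refine (Finset.abs_sum_le_sum_abs _ _).trans_eq (Finset.sum_congr rfl fun i _ => ?_)
    rw [abs_mul, abs_of_nonneg (hw i)]
  have h2 := h1.trans (Real.inner_le_weight_mul_Lp_of_nonneg t hp w (fun i => |f i|) hw
    fun i => abs_nonneg _)
  rw [abs_mul, abs_of_pos (by positivity), Real.rpow_neg hV.le]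
  rw [← Real.rpow_le_rpow_iff (z := p⁻¹) (by positivity) hnn (by positivity),
    Real.rpow_rpow_inv (by positivity) hp0.ne', inv_mul_le_iff₀ (by positivity)]
  exact h2

/-- Choosing one interval of length `L n` after each `M n`, some subsequence assigns to the `j`-th
point of the `n`-th interval a weight at least `w (M n + j)`. -/
theorem exists_strictMono_tsum_le_garlingSum {w : ℕ → ℝ} (hw : Antitone w) {M L σ : ℕ → ℕ}
    (hL : ∀ n, 0 < L n) (hσ : ∀ n, M n ≤ σ n) (hM : ∀ n, σ n + L n ≤ M (n + 1)) :
    ∃ φ, StrictMono φ ∧ ∀ b : ℕ → ℝ≥0∞,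
      ∑' n, ∑ j ∈ Finset.range (L n), b (σ n + j) * ENNReal.ofReal (w (M n + j)) ≤
        garlingSum w φ b := by
  classical
  let A : ℕ → Prop := fun a => ∃ n, σ n ≤ a ∧ a < σ n + L n
  have hMmono : Monotone M := monotone_nat_of_le_succ fun n => by
    have := hσ n
    have := hM n
    omega
  have hσlt : ∀ {n n' : ℕ}, n < n' → σ n + L n ≤ M n' := fun h => (hM _).trans (hMmono h)
  have hσmono : StrictMono σ := fun n n' h => by
    have := hσlt h
    have := hσ n'
    have := hL n
    omega
  have hmem : ∀ n, ∀ j < L n, A (σ n + j) := fun n j hj => ⟨n, by omega, by omega⟩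
  have hA : {a | A a}.Infinite :=
    Set.infinite_of_injective_forall_mem hσmono.injective fun n => hmem n 0 (hL n)
  have hcount : ∀ n j, Nat.count A (σ n + j) ≤ M n + j := fun n j => by
    obtain ⟨d, hd⟩ := Nat.exists_eq_add_of_le (hσ n)
    have h0 : Nat.count (fun k => A (M n + k)) d = 0 := by
      rw [Nat.count_eq_card_filter_range, Finset.card_eq_zero, Finset.filter_eq_empty_iff]
      rintro k hk ⟨m, hm1, hm2⟩
      rw [Finset.mem_range] at hk
      rcases lt_trichotomy m n with h | rfl | h
      · have := hσlt h
        omega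
      · omega
      · have := hσlt h
        have := hσ m
        omega
    rw [Nat.count_add, hd, Nat.count_add, h0, add_zero]
    exact add_le_add (Nat.count_le _) (Nat.count_le _)
  refine ⟨Nat.nth A, Nat.nth_strictMono hA, fun b => ?_⟩
  let q : (Σ n, Fin (L n)) → ℕ := fun t => σ t.1 + t.2
  have hqA : ∀ t, A (q t) := fun t => hmem _ _ t.2.2
  have hq : Function.Injective q := by
    rintro ⟨n, j, hj⟩ ⟨n', j', hj'⟩ h
    dsimp only [q] at h
    rcases lt_trichotomy n n' with hn | rfl | hn
    · have := hσlt hn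
      have := hσ n'
      omega
    · obtain rfl : j = j' := by omega
      rfl
    · have := hσlt hn
      have := hσ n
      omega
  have hinj : Function.Injective fun t => Nat.count A (q t) := fun t t' h =>
    hq (Nat.count_injective (hqA t) (hqA t') h)
  calc ∑' n, ∑ j ∈ Finset.range (L n), b (σ n + j) * ENNReal.ofReal (w (M n + j))
      = ∑' t : Σ n, Fin (L n), b (q t) * ENNReal.ofReal (w (M t.1 + t.2)) := by
        rw [ENNReal.tsum_sigma']
        refine tsum_congr fun n => ?_
        rw [tsum_fintype, Finset.sum_range]
    _ ≤ ∑' t : Σ n, Fin (L n),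
          b (Nat.nth A (Nat.count A (q t))) * ENNReal.ofReal (w (Nat.count A (q t))) := by
        refine ENNReal.tsum_le_tsum fun t => ?_
        rw [Nat.nth_count (hqA t)]
        gcongr
        exact hw (hcount _ _)
    _ ≤ garlingSum w (Nat.nth A) b :=
        ENNReal.tsum_comp_le_tsum_of_injective hinj
          fun k => b (Nat.nth A k) * ENNReal.ofReal (w k)

theorem garlingNorm_eq_iSup_garlingSum (p : ℝ) (w f : ℕ → ℝ) :
    garlingNorm p w f = ⨆ φ : {φ : ℕ → ℕ // StrictMono φ},
      (garlingSum w φ.1 fun a => ENNReal.ofReal (|f a| ^ p)) ^ (1 / p) := by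
  simp only [garlingNorm, garlingSum]
  congr! 5 with φ
  exact ENNReal.ofReal_mul (by positivity)

/-- **Theorem (complemented Besov subspace).** For each `ε > 0` there are linear maps
`S : (⊕_n ℓ_∞^n)_p → g(w,p)` and `P : g(w,p) → (⊕_n ℓ_∞^n)_p` with `P ∘ S = Id`,
`‖S‖ ≤ (1+ε)^{1/2}`, `‖P‖ ≤ (1+ε)^{1/2}`, and `S` carries the unit vectors to
nonnegative, pairwise disjointly supported vectors of `g(w,p)`; hence the range of `S`
is a sublattice of `g(w,p)` which is `(1+ε)`-lattice isomorphic to `(⊕_n ℓ_∞^n)_p` and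
`(1+ε)`-complemented in `g(w,p)`. -/
theorem garling_contains_complemented_besov (p : ℝ) (hp : 1 ≤ p) (w : ℕ → ℝ)
    (hw : IsGarlingWeight w) (ε : ℝ) (hε : 0 < ε) :
    ∃ (S : ((n : ℕ) → Fin (n + 1) → ℝ) → (ℕ → ℝ))
      (P : (ℕ → ℝ) → ((n : ℕ) → Fin (n + 1) → ℝ)),
      IsLinearMap ℝ S ∧ IsLinearMap ℝ P ∧
      (∀ x, P (S x) = x) ∧
      (∀ x, garlingNorm p w (S x) ≤
          ENNReal.ofReal (Real.sqrt (1 + ε)) * besovNorm p x) ∧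
      (∀ f, besovNorm p (P f) ≤
          ENNReal.ofReal (Real.sqrt (1 + ε)) * garlingNorm p w f) ∧
      (∀ n (i : Fin (n + 1)) (j : ℕ), 0 ≤ S (besovUnit n i) j) ∧
      (∀ n (i : Fin (n + 1)) n' (i' : Fin (n' + 1)),
        (n, (i : ℕ)) ≠ (n', (i' : ℕ)) →
          Disjoint (Function.support (S (besovUnit n i)))
            (Function.support (S (besovUnit n' i')))) := by
  obtain ⟨δ, hδ, hδε⟩ : ∃ δ : ℝ, 0 < δ ∧ 1 + δ = √(1 + ε) :=
    ⟨√(1 + ε) - 1, sub_pos.2 (Real.lt_sqrt_of_sq_lt (by linarith)), by ring⟩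
  have hp0 : 0 < p := by linarith
  obtain ⟨M, N, s, U, hN, hMs, hsM, hs, hval, hU⟩ := exists_block_system hw hδ
  have hMmono : Monotone M := monotone_nat_of_le_succ fun n => by
    have := hMs n 0
    have := hsM n 0
    omega
  let V : (n : ℕ) → Fin (n + 1) → ℝ := fun n i => ∑ k ∈ Finset.range (N n i), w (M n + k)
  have hV : ∀ n i, 0 < V n i := fun n i =>
    Finset.sum_pos (fun _ _ => hw.2.1 _) ⟨0, Finset.mem_range.2 (hN n i)⟩
  let pos : (Σ n, Σ i : Fin (n + 1), Fin (N n i)) → ℕ := fun t => s t.1 t.2.1 + t.2.2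
  have hlt : ∀ {n n'} (i : Fin (n + 1)) (i' : Fin (n' + 1)), n < n' →
      s n i + N n i ≤ s n' i' := fun i i' h =>
    (hsM _ i).trans ((hMmono h).trans (hMs _ i'))
  have hpos : Function.Injective pos := by
    rintro ⟨n, i, j, hj⟩ ⟨n', i', j', hj'⟩ h
    dsimp only [pos] at h
    rcases lt_trichotomy n n' with hn | rfl | hn
    · have := hlt i i' hn
      omega
    · rcases lt_trichotomy i i' with hi | rfl | hi
      · have := hs n i i' hi
        omega
      · obtain rfl : j = j' := by omega
        rfl
      · have := hs n i' i hi
        omega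
    · have := hlt i' i hn
      omega
  let S : ((n : ℕ) → Fin (n + 1) → ℝ) → ℕ → ℝ := fun x =>
    Function.extend pos (fun t => x t.1 t.2.1 * V t.1 t.2.1 ^ (-p⁻¹)) 0
  have hSpos : ∀ x t, S x (pos t) = x t.1 t.2.1 * V t.1 t.2.1 ^ (-p⁻¹) := fun x t =>
    hpos.extend_apply _ _ t
  have hSnot : ∀ x a, (¬∃ t, pos t = a) → S x a = 0 := fun x a ha =>
    Function.extend_apply' _ _ _ ha
  let P : (ℕ → ℝ) → (n : ℕ) → Fin (n + 1) → ℝ := fun f n i =>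
    V n i ^ (-(1 - p⁻¹)) * ∑ j ∈ Finset.range (N n i), w (M n + j) * f (s n i + j)
  refine ⟨S, P, ⟨fun x y => ?_, fun c x => ?_⟩, ⟨fun f g => ?_, fun c f => ?_⟩, fun x => ?_,
    fun x => ?_, fun f => ?_, fun n i a => ?_, fun n i n' i' hne => ?_⟩
  · ext a
    by_cases ha : ∃ t, pos t = a
    · obtain ⟨t, rfl⟩ := ha
      simp only [Pi.add_apply, hSpos, add_mul]
    · simp only [Pi.add_apply, hSnot _ _ ha, add_zero]
  · ext a
    by_cases ha : ∃ t, pos t = a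
    · obtain ⟨t, rfl⟩ := ha
      simp only [Pi.smul_apply, hSpos, smul_eq_mul, mul_assoc]
    · simp only [Pi.smul_apply, hSnot _ _ ha, smul_zero]
  · ext n i
    simp only [P, Pi.add_apply, mul_add, Finset.sum_add_distrib]
  · ext n i
    simp only [P, Pi.smul_apply, smul_eq_mul, mul_left_comm _ c, ← Finset.mul_sum]
  · ext n i
    have h : ∀ j ∈ Finset.range (N n i), w (M n + j) * S x (s n i + j) =
        w (M n + j) * (x n i * V n i ^ (-p⁻¹)) := fun j hj => by
      rw [← hSpos x ⟨n, i, j, Finset.mem_range.1 hj⟩]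
    simp only [P]
    rw [Finset.sum_congr rfl h, ← Finset.sum_mul]
    change V n i ^ (-(1 - p⁻¹)) * (V n i * (x n i * V n i ^ (-p⁻¹))) = x n i
    calc _ = V n i ^ (-(1 - p⁻¹)) * V n i ^ (1 : ℝ) * V n i ^ (-p⁻¹) * x n i := by
          rw [Real.rpow_one]
          ring
      _ = x n i := by
          rw [← Real.rpow_add (hV n i), ← Real.rpow_add (hV n i),
            show -(1 - p⁻¹) + 1 + -p⁻¹ = 0 by ring, Real.rpow_zero, one_mul]
  · rw [garlingNorm_eq_iSup_garlingSum, ← hδε]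
    refine iSup_le fun ⟨φ, hφ⟩ => ?_
    let T : ℕ → ℝ≥0∞ := fun n => (⨆ i : Fin (n + 1), ENNReal.ofReal |x n i|) ^ p
    have hST : ∀ a, ENNReal.ofReal (|S x a| ^ p) ≤ ∑' n, T n * U n a := fun a => by
      by_cases ha : ∃ t, pos t = a
      · obtain ⟨⟨n, i, j⟩, rfl⟩ := ha
        refine le_trans ?_ (ENNReal.le_tsum n)
        rw [hSpos, hval n i j j.2, abs_mul, abs_of_pos (Real.rpow_pos_of_pos (hV n i) _),
          Real.mul_rpow (abs_nonneg _) (Real.rpow_pos_of_pos (hV n i) _).le,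
          ← Real.rpow_mul (hV n i).le, neg_mul, inv_mul_cancel₀ hp0.ne', Real.rpow_neg_one,
          ENNReal.ofReal_mul (by positivity), one_div]
        gcongr
        rw [← ENNReal.ofReal_rpow_of_nonneg (abs_nonneg _) hp0.le]
        exact ENNReal.rpow_le_rpow (le_iSup (fun i => ENNReal.ofReal |x n i|) i) hp0.le
      · rw [hSnot _ _ ha, abs_zero, Real.zero_rpow hp0.ne', ENNReal.ofReal_zero]
        exact zero_le
    have hsum : garlingSum w φ (fun a => ENNReal.ofReal (|S x a| ^ p)) ≤
        ENNReal.ofReal (1 + δ) * ∑' n, T n := by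
      calc _ ≤ ∑' j, ∑' n, T n * (U n (φ j) * ENNReal.ofReal (w j)) := by
            refine ENNReal.tsum_le_tsum fun j => ?_
            simp only [← mul_assoc]
            rw [ENNReal.tsum_mul_right]
            exact mul_le_mul' (hST _) le_rfl
        _ = ∑' n, T n * garlingSum w φ (U n) := by
            rw [ENNReal.tsum_comm]
            simp only [ENNReal.tsum_mul_left, garlingSum]
        _ ≤ ∑' n, T n * ENNReal.ofReal (1 + δ) :=
            ENNReal.tsum_le_tsum fun n => mul_le_mul' le_rfl (hU n φ hφ)
        _ = _ := by rw [ENNReal.tsum_mul_right, mul_comm]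
    refine (ENNReal.rpow_le_rpow hsum (by positivity)).trans ?_
    rw [ENNReal.mul_rpow_of_nonneg _ _ (by positivity)]
    refine mul_le_mul' ?_ le_rfl
    calc ENNReal.ofReal (1 + δ) ^ (1 / p) ≤ ENNReal.ofReal (1 + δ) ^ (1 : ℝ) :=
          ENNReal.rpow_le_rpow_of_exponent_le (ENNReal.one_le_ofReal.2 (by linarith))
            ((div_le_one hp0).2 hp)
      _ = ENNReal.ofReal (1 + δ) := ENNReal.rpow_one _
  · have hmax : ∀ n, ∃ i, ⨆ i, ENNReal.ofReal |P f n i| = ENNReal.ofReal |P f n i| := fun n => by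
      obtain ⟨i, hi⟩ := Finite.exists_max fun i => ENNReal.ofReal |P f n i|
      exact ⟨i, le_antisymm (iSup_le hi) (le_iSup (fun i => ENNReal.ofReal |P f n i|) i)⟩
    choose i hi using hmax
    obtain ⟨φ, hφ, hle⟩ := exists_strictMono_tsum_le_garlingSum hw.antitone (M := M)
      (L := fun n => N n (i n)) (σ := fun n => s n (i n)) (fun n => hN n _) (fun n => hMs n _)
      fun n => hsM n _
    have hsum : ∑' n, (⨆ i, ENNReal.ofReal |P f n i|) ^ p ≤
        garlingSum w φ fun a => ENNReal.ofReal (|f a| ^ p) := by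
      refine (ENNReal.tsum_le_tsum fun n => ?_).trans (hle _)
      rw [hi, ENNReal.ofReal_rpow_of_nonneg (abs_nonneg _) hp0.le]
      refine (ENNReal.ofReal_le_ofReal (abs_weighted_mean_rpow_le _ hp (fun j => w (M n + j))
        (fun j => f (s n (i n) + j)) (fun j => (hw.2.1 _).le) (hV n (i n)))).trans_eq ?_
      rw [ENNReal.ofReal_sum_of_nonneg fun j _ => mul_nonneg (hw.2.1 _).le (by positivity)]
      refine Finset.sum_congr rfl fun j _ => ?_
      rw [mul_comm, ENNReal.ofReal_mul (by positivity)]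
    have hone : 1 ≤ ENNReal.ofReal √(1 + ε) := ENNReal.one_le_ofReal.2 (by linarith)
    refine le_trans ?_ (le_mul_of_one_le_left zero_le hone)
    rw [garlingNorm_eq_iSup_garlingSum]
    exact (ENNReal.rpow_le_rpow hsum (by positivity)).trans
      (le_iSup (fun φ : {φ : ℕ → ℕ // StrictMono φ} =>
        (garlingSum w φ.1 fun a => ENNReal.ofReal (|f a| ^ p)) ^ (1 / p)) ⟨φ, hφ⟩)
  · by_cases ha : ∃ t, pos t = a
    · obtain ⟨t, rfl⟩ := ha
      rw [hSpos]
      refine mul_nonneg ?_ (Real.rpow_pos_of_pos (hV _ _) _).le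
      unfold besovUnit
      split_ifs <;> norm_num
    · rw [hSnot _ _ ha]
  · rw [Set.disjoint_left]
    intro a ha ha'
    by_cases h : ∃ t, pos t = a
    · obtain ⟨t, rfl⟩ := h
      rw [Function.mem_support, hSpos] at ha ha'
      have h1 := left_ne_zero_of_mul ha
      have h2 := left_ne_zero_of_mul ha'
      simp only [besovUnit, ne_eq, ite_eq_right_iff, one_ne_zero, imp_false, not_not] at h1 h2
      exact hne (Prod.ext (h1.1.symm.trans h2.1) (h1.2.symm.trans h2.2))
    · exact ha (hSnot _ _ h)

end
end

section
/- Let 1 ≤ p < ∞ and w ∈ 𝒲. For every n ∈ ℕ and every ε > 0 there is a linear map T : ℝ^n → g(w,p) such that ‖x‖_∞ ≤ ‖T(x)‖_g ≤ (1+ε) ‖x‖_∞ for all x ∈ ℝ^n; that is, ℓ_∞ is finitely representable in g(w,p). -/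
open Filter
open scoped ENNReal NNReal

noncomputable section

/-- Profile of the `p`-th powers of the block vectors: `n` consecutive constant blocks, labelled
by `ι`, each of modular at least `1`, whose sum has modular at most `1 + n * δ`. -/
theorem exists_garling_blocks {w : ℕ → ℝ} (hw : IsGarlingWeight w) {δ : ℝ} (hδ : 0 < δ) (n : ℕ) :
    ∃ (b : ℕ → ℝ) (ι : ℕ → ℕ), (∀ k, 0 ≤ b k) ∧ Summable b ∧
      (∀ φ : ℕ → ℕ, StrictMono φ → ∀ K, ∑ j ∈ Finset.range K, b (φ j) * w j ≤ 1 + n * δ) ∧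
      ∀ i < n, ∃ s L, (∀ j < L, ι (s + j) = i) ∧
        1 ≤ ∑ j ∈ Finset.range L, b (s + j) * w j := by
  obtain ⟨-, hpos, hanti, hlim, hsum⟩ := hw
  have hanti : Antitone w := antitone_nat_of_succ_le hanti
  have hWmono : Monotone fun N => ∑ j ∈ Finset.range N, w j := fun a b hab =>
    Finset.sum_le_sum_of_subset_of_nonneg (by simpa using hab) fun j _ _ => (hpos j).le
  induction n with
  | zero => exact ⟨0, 0, by simp, summable_zero, by simp, by simp⟩
  | succ n ih =>
    obtain ⟨b, ι, hb, hbs, hup, hlow⟩ := ih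
    obtain ⟨M, hM⟩ : ∃ M, ∀ m ≥ M, w m * ∑' k, b k ≤ δ := by
      have h : Tendsto (fun m => w m * ∑' k, b k) atTop (nhds 0) := by
        simpa using hlim.mul_const (∑' k, b k)
      exact eventually_atTop.1 (h.eventually_le_const hδ)
    obtain ⟨N, hN1, hNM⟩ : ∃ N, 1 ≤ ∑ j ∈ Finset.range N, w j ∧
        (∑ j ∈ Finset.range M, w j) / δ ≤ ∑ j ∈ Finset.range N, w j := by
      have h := (not_summable_iff_tendsto_nat_atTop_of_nonneg fun j => (hpos j).le).1 hsum
      exact ((h.eventually_ge_atTop _).and (h.eventually_ge_atTop _)).exists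
    set W := ∑ j ∈ Finset.range N, w j with hW
    have hW0 : 0 < W := by linarith
    have hnn : ∀ k, 0 ≤ if k < N then W⁻¹ else b (k - N) := fun k => by
      split_ifs
      · positivity
      · exact hb _
    refine ⟨fun k => if k < N then W⁻¹ else b (k - N),
      fun k => if k < N then n else ι (k - N), hnn, ?_, ?_, ?_⟩
    · rw [← summable_nat_add_iff N]
      simpa using hbs
    · intro φ hφ K
      have hex : ∃ m, N ≤ φ m := ⟨N, hφ.id_le N⟩
      obtain ⟨m, hm, hlt⟩ : ∃ m, N ≤ φ m ∧ ∀ j < m, φ j < N :=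
        ⟨Nat.find hex, Nat.find_spec hex, fun j hj => not_le.1 (Nat.find_min hex hj)⟩
      have hge : ∀ i, N ≤ φ (m + i) := fun i => hm.trans (hφ.monotone (Nat.le_add_right _ _))
      have hmN : m ≤ N := by
        by_contra! h
        exact absurd (hlt N h) (not_lt.2 (hφ.id_le N))
      have hψ : StrictMono fun i => φ (m + i) - N := fun i j hij => by
        have h1 : φ (m + i) < φ (m + j) := hφ (by omega)
        have h2 := hge i
        show φ (m + i) - N < φ (m + j) - N
        omega
      have hsplit : ∑ j ∈ Finset.range K, (if φ j < N then W⁻¹ else b (φ j - N)) * w j ≤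
          (∑ j ∈ Finset.range m, w j) / W +
            ∑ i ∈ Finset.range K, b (φ (m + i) - N) * w (m + i) := by
        calc _ ≤ ∑ j ∈ Finset.range (m + K), (if φ j < N then W⁻¹ else b (φ j - N)) * w j :=
              Finset.sum_le_sum_of_subset_of_nonneg (by simp)
                fun j _ _ => mul_nonneg (hnn _) (hpos j).le
          _ = _ := by
              rw [Finset.sum_range_add, Finset.sum_div]
              congr 1
              · refine Finset.sum_congr rfl fun j hj => ?_
                rw [if_pos (hlt j (Finset.mem_range.1 hj)), div_eq_inv_mul]
              · refine Finset.sum_congr rfl fun i _ => ?_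
                rw [if_neg (not_lt.2 (hge i))]
      refine hsplit.trans ?_
      push_cast
      rcases le_total m M with hmM | hmM
      · have h1 : (∑ j ∈ Finset.range m, w j) / W ≤ δ := by
          rw [div_le_iff₀ hδ] at hNM
          rw [div_le_iff₀ hW0]
          have := hWmono hmM
          dsimp only at this
          linarith
        have h2 : ∑ i ∈ Finset.range K, b (φ (m + i) - N) * w (m + i) ≤ 1 + n * δ :=
          (Finset.sum_le_sum fun i _ =>
            mul_le_mul_of_nonneg_left (hanti (Nat.le_add_left i m)) (hb _)).trans (hup _ hψ K)
        linarith
      · have h1 : (∑ j ∈ Finset.range m, w j) / W ≤ 1 := (div_le_one hW0).2 (hWmono hmN)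
        have h2 : ∑ i ∈ Finset.range K, b (φ (m + i) - N) * w (m + i) ≤ δ :=
          calc _ ≤ ∑ i ∈ Finset.range K, b (φ (m + i) - N) * w m :=
                Finset.sum_le_sum fun i _ =>
                  mul_le_mul_of_nonneg_left (hanti (Nat.le_add_right m i)) (hb _)
            _ = w m * ∑ i ∈ Finset.range K, b (φ (m + i) - N) := by
                rw [← Finset.sum_mul, mul_comm]
            _ ≤ w m * ∑' k, b k := by
                refine mul_le_mul_of_nonneg_left ?_ (hpos m).le
                rw [← Finset.sum_image (f := b) hψ.injective.injOn]
                exact hbs.sum_le_tsum _ fun k _ => hb k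
            _ ≤ δ := hM m hmM
        have h3 : 0 ≤ (n : ℝ) * δ := by positivity
        linarith
    · intro i hi
      rcases Nat.lt_succ_iff_lt_or_eq.1 hi with hi | rfl
      · obtain ⟨s, L, h1, h2⟩ := hlow i hi
        have hs : ∀ j, N + s + j - N = s + j := fun j => by omega
        have hs' : ∀ j, ¬ N + s + j < N := fun j => by omega
        exact ⟨N + s, L, by simpa [hs, hs'] using h1, by simpa [hs, hs'] using h2⟩
      · refine ⟨0, N, fun j hj => by simp [hj], ?_⟩
        rw [Finset.sum_congr rfl fun j hj =>
          show _ = W⁻¹ * w j by simp [Finset.mem_range.1 hj], ← Finset.mul_sum, ← hW,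
          inv_mul_cancel₀ hW0.ne']

theorem garlingNorm_le_of_sum_range_le {p : ℝ} (hp : 0 < p) {w f : ℕ → ℝ} (hw : ∀ j, 0 ≤ w j)
    {C : ℝ} (h : ∀ φ : ℕ → ℕ, StrictMono φ → ∀ K,
      ∑ j ∈ Finset.range K, |f (φ j)| ^ p * w j ≤ C) :
    garlingNorm p w f ≤ ENNReal.ofReal (C ^ (1 / p)) := by
  have hC : 0 ≤ C := by simpa using h id strictMono_id 0
  refine iSup_le fun φ => ?_
  rw [← ENNReal.ofReal_rpow_of_nonneg hC (by positivity)]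
  refine ENNReal.rpow_le_rpow ?_ (by positivity)
  refine ENNReal.tsum_le_of_sum_range_le fun K => ?_
  rw [← ENNReal.ofReal_sum_of_nonneg fun j _ => mul_nonneg (by positivity) (hw j)]
  exact ENNReal.ofReal_le_ofReal (h φ.1 φ.2 K)

theorem ofReal_rpow_sum_range_le_garlingNorm {p : ℝ} (hp : 0 < p) {w f : ℕ → ℝ}
    (hw : ∀ j, 0 ≤ w j) {φ : ℕ → ℕ} (hφ : StrictMono φ) (K : ℕ) :
    ENNReal.ofReal ((∑ j ∈ Finset.range K, |f (φ j)| ^ p * w j) ^ (1 / p)) ≤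
      garlingNorm p w f := by
  have hnn : ∀ j ∈ Finset.range K, 0 ≤ |f (φ j)| ^ p * w j := fun j _ =>
    mul_nonneg (by positivity) (hw j)
  refine le_iSup_of_le ⟨φ, hφ⟩ ?_
  rw [← ENNReal.ofReal_rpow_of_nonneg (Finset.sum_nonneg hnn) (by positivity)]
  refine ENNReal.rpow_le_rpow ?_ (by positivity)
  rw [ENNReal.ofReal_sum_of_nonneg hnn]
  exact ENNReal.sum_le_tsum _

/-- The linear map sending `x` to the sequence `k ↦ x (ι k) * c k`, read as `0` where the label
`ι k` is out of range. -/
def blockMap {n : ℕ} (ι : ℕ → ℕ) (c : ℕ → ℝ) : (Fin n → ℝ) →ₗ[ℝ] (ℕ → ℝ) where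
  toFun x k := extendTuple x (ι k) * c k
  map_add' x y := by
    ext k
    by_cases h : ι k < n <;> simp [extendTuple, h, add_mul]
  map_smul' r x := by
    ext k
    by_cases h : ι k < n <;> simp [extendTuple, h, mul_assoc]

theorem abs_blockMap_rpow {n : ℕ} {p : ℝ} (hp : 0 < p) (ι : ℕ → ℕ) {b : ℕ → ℝ}
    (hb : ∀ k, 0 ≤ b k) (x : Fin n → ℝ) (k : ℕ) :
    |blockMap ι (fun k => b k ^ (1 / p)) x k| ^ p = |extendTuple x (ι k)| ^ p * b k := by
  have h := hb k
  have h' : 0 ≤ b k ^ (1 / p) := by positivity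
  change |extendTuple x (ι k) * b k ^ (1 / p)| ^ p = _
  rw [abs_mul, abs_of_nonneg h', Real.mul_rpow (abs_nonneg _) h', ← Real.rpow_mul h,
    one_div_mul_cancel hp.ne', Real.rpow_one]

theorem abs_extendTuple_le_norm {n : ℕ} (x : Fin n → ℝ) (k : ℕ) : |extendTuple x k| ≤ ‖x‖ := by
  by_cases h : k < n
  · simpa [extendTuple, h] using norm_le_pi_norm x ⟨k, h⟩
  · simp [extendTuple, h]

/-- **`ℓ_∞` is finitely representable in `g(w,p)`.** For every `n` and `ε > 0` there is a
linear map `T : ℓ_∞^n → g(w,p)` with `‖x‖_∞ ≤ ‖T x‖_g ≤ (1+ε)‖x‖_∞` for all `x`.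
(The norm on `Fin n → ℝ` is the sup norm.) -/
theorem linfty_finitely_representable_in_garling (p : ℝ) (hp : 1 ≤ p) (w : ℕ → ℝ)
    (hw : IsGarlingWeight w) (n : ℕ) (ε : ℝ) (hε : 0 < ε) :
    ∃ T : (Fin n → ℝ) →ₗ[ℝ] (ℕ → ℝ),
      ∀ x : Fin n → ℝ,
        ENNReal.ofReal ‖x‖ ≤ garlingNorm p w (T x) ∧
        garlingNorm p w (T x) ≤ ENNReal.ofReal ((1 + ε) * ‖x‖) := by
  have hp0 : 0 < p := by linarith
  have hw0 : ∀ j, 0 ≤ w j := fun j => (hw.2.1 j).le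
  obtain ⟨b, ι, hb, -, hup, hlow⟩ :=
    exists_garling_blocks hw (δ := ε / (n + 1)) (by positivity) n
  refine ⟨blockMap ι fun k => b k ^ (1 / p), fun x => ⟨?_, ?_⟩⟩
  · rcases isEmpty_or_nonempty (Fin n) with hn | hn
    · simp [Subsingleton.elim x 0]
    obtain ⟨i, hi⟩ := Finite.exists_max fun i => ‖x i‖
    obtain ⟨s, L, hι, hs⟩ := hlow i i.2
    refine le_trans (ENNReal.ofReal_le_ofReal ?_)
      (ofReal_rpow_sum_range_le_garlingNorm hp0 hw0 (φ := fun j => s + j)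
        (fun _ _ h => Nat.add_lt_add_left h s) L)
    rw [one_div, Real.le_rpow_inv_iff_of_pos (norm_nonneg x)
      (Finset.sum_nonneg fun j _ => mul_nonneg (by positivity) (hw0 j)) hp0]
    calc ‖x‖ ^ p ≤ |x i| ^ p := by
          refine Real.rpow_le_rpow (norm_nonneg _) ?_ hp0.le
          exact (pi_norm_le_iff_of_nonneg (abs_nonneg _)).2 hi
      _ ≤ |x i| ^ p * ∑ j ∈ Finset.range L, b (s + j) * w j :=
          le_mul_of_one_le_right (by positivity) hs
      _ = _ := by
          rw [Finset.mul_sum]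
          refine Finset.sum_congr rfl fun j hj => ?_
          rw [← one_div, abs_blockMap_rpow hp0 ι hb, hι j (Finset.mem_range.1 hj)]
          simp [extendTuple, mul_assoc]
  · refine (garlingNorm_le_of_sum_range_le hp0 hw0 (C := ‖x‖ ^ p * (1 + ε)) ?_).trans
      (ENNReal.ofReal_le_ofReal ?_)
    · intro φ hφ K
      calc _ ≤ ∑ j ∈ Finset.range K, ‖x‖ ^ p * (b (φ j) * w j) := by
            refine Finset.sum_le_sum fun j _ => ?_
            rw [abs_blockMap_rpow hp0 ι hb, mul_assoc]
            exact mul_le_mul_of_nonneg_right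
              (Real.rpow_le_rpow (abs_nonneg _) (abs_extendTuple_le_norm x _) hp0.le)
              (mul_nonneg (hb _) (hw0 j))
        _ = ‖x‖ ^ p * ∑ j ∈ Finset.range K, b (φ j) * w j := by rw [Finset.mul_sum]
        _ ≤ ‖x‖ ^ p * (1 + ε) := by
            refine mul_le_mul_of_nonneg_left ((hup φ hφ K).trans ?_) (by positivity)
            have h : (n : ℝ) * (ε / (n + 1)) ≤ ε := by
              rw [mul_div_assoc', div_le_iff₀ (by positivity)]
              nlinarith
            linarith
    · rw [Real.mul_rpow (by positivity) (by positivity), ← Real.rpow_mul (norm_nonneg x),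
        mul_one_div_cancel hp0.ne', Real.rpow_one, mul_comm]
      refine mul_le_mul_of_nonneg_right ?_ (norm_nonneg x)
      exact Real.rpow_le_self_of_one_le (by linarith) ((div_le_one hp0).2 hp)

end
end

section
/- Let 1 ≤ p < ∞ and w ∈ 𝒲. The Banach space g(w,p) is not superreflexive; in particular, there is no equivalent norm ||| · ||| on g(w,p) (i.e., a norm satisfying c‖f‖_g ≤ |||f||| ≤ C‖f‖_g for some constants 0 < c ≤ C) which is uniformly convex. -/
open Filter
open scoped ENNReal NNReal

noncomputable section

/-- Prepending to a `p`-summable sequence a long flat block of unit energy barely increases the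
supremum of the energies along subsequences. Here `G` plays the role of `|F| ^ p`. -/
lemma exists_flat_block {w : ℕ → ℝ} (hw : IsGarlingWeight w) {G : ℕ → ℝ≥0∞}
    (hG : ∑' i, G i ≠ ⊤) {R η : ℝ} (hR : 1 ≤ R) (hη : 0 < η)
    (hGR : ∀ φ : ℕ → ℕ, StrictMono φ →
      ∑' j, G (φ j) * ENNReal.ofReal (w j) ≤ ENNReal.ofReal R) :
    ∃ (L : ℕ) (t : ℝ), 0 < t ∧ t * ∑ j ∈ Finset.range L, w j = 1 ∧
      ∀ φ : ℕ → ℕ, StrictMono φ →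
        ∑' j, (if φ j < L then ENNReal.ofReal t else G (φ j - L)) * ENNReal.ofReal (w j)
          ≤ ENNReal.ofReal (R + η) := by
  obtain ⟨-, hpos, hstep, hlim, hsum⟩ := hw
  have hanti : Antitone w := antitone_nat_of_succ_le hstep
  have hW : Tendsto (fun n => ∑ j ∈ Finset.range n, w j) atTop atTop :=
    (not_summable_iff_tendsto_nat_atTop_of_nonneg fun n => (hpos n).le).1 hsum
  have hWmono : Monotone fun n => ∑ j ∈ Finset.range n, w j := fun a b hab =>
    Finset.sum_le_sum_of_subset_of_nonneg (Finset.range_mono hab) fun i _ _ => (hpos i).le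
  set S : ℝ := (∑' i, G i).toReal with hS
  have hlimS : Tendsto (fun n => w n * S) atTop (nhds 0) := by simpa using hlim.mul_const S
  obtain ⟨K₀, hK₀⟩ := eventually_atTop.1 (hlimS.eventually (ge_mem_nhds hη))
  obtain ⟨L, hL₁, hL₂⟩ := ((hW.eventually_ge_atTop 1).and
    (hW.eventually_ge_atTop ((∑ j ∈ Finset.range K₀, w j) / η))).exists
  set V : ℝ := ∑ j ∈ Finset.range L, w j with hV
  have hVpos : 0 < V := by linarith
  refine ⟨L, V⁻¹, by positivity, inv_mul_cancel₀ hVpos.ne', fun φ hφ => ?_⟩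
  have hex : ∃ k, L ≤ φ k := ⟨L, hφ.le_apply⟩
  classical
  set K := Nat.find hex
  have hlt : ∀ j, j < K → φ j < L := fun j hj => not_le.1 (Nat.find_min hex hj)
  have hge : ∀ j, L ≤ φ (j + K) := fun j =>
    (Nat.find_spec hex).trans (hφ.monotone (Nat.le_add_left _ _))
  have hKL : K ≤ L := Nat.find_min' hex hφ.le_apply
  have hψ : StrictMono fun j => φ (j + K) - L := fun a b hab => by
    have h₁ := hge a
    have h₂ := hφ (Nat.add_lt_add_right hab K)
    show φ (a + K) - L < φ (b + K) - L
    omega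
  rw [← ENNReal.summable.sum_add_tsum_nat_add' (k := K)]
  have hhead : ∑ j ∈ Finset.range K,
      (if φ j < L then ENNReal.ofReal V⁻¹ else G (φ j - L)) * ENNReal.ofReal (w j)
      = ENNReal.ofReal (V⁻¹ * ∑ j ∈ Finset.range K, w j) := by
    rw [ENNReal.ofReal_mul (by positivity), ENNReal.ofReal_sum_of_nonneg fun i _ => (hpos i).le,
      Finset.mul_sum]
    refine Finset.sum_congr rfl fun j hj => ?_
    rw [if_pos (hlt j (Finset.mem_range.1 hj))]
  have htail : ∑' j, (if φ (j + K) < L then ENNReal.ofReal V⁻¹ else G (φ (j + K) - L))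
      * ENNReal.ofReal (w (j + K)) = ∑' j, G (φ (j + K) - L) * ENNReal.ofReal (w (j + K)) :=
    tsum_congr fun j => by rw [if_neg (not_lt.2 (hge j))]
  rw [hhead, htail]
  rcases le_total K₀ K with h | h
  · rw [ENNReal.ofReal_add (by linarith) hη.le]
    refine add_le_add (ENNReal.ofReal_le_ofReal ?_) ?_
    · calc V⁻¹ * ∑ j ∈ Finset.range K, w j ≤ V⁻¹ * V := by
            gcongr
            exact hWmono hKL
        _ = 1 := inv_mul_cancel₀ hVpos.ne'
        _ ≤ R := hR
    · calc ∑' j, G (φ (j + K) - L) * ENNReal.ofReal (w (j + K))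
          ≤ ∑' j, G (φ (j + K) - L) * ENNReal.ofReal (w K) := by
            gcongr with j
            exact hanti (Nat.le_add_left _ _)
        _ = (∑' j, G (φ (j + K) - L)) * ENNReal.ofReal (w K) := ENNReal.tsum_mul_right
        _ ≤ (∑' i, G i) * ENNReal.ofReal (w K) :=
            mul_le_mul_left (ENNReal.tsum_comp_le_tsum_of_injective hψ.injective G) _
        _ = ENNReal.ofReal (w K * S) := by
            rw [ENNReal.ofReal_mul (hpos K).le, hS, ENNReal.ofReal_toReal hG, mul_comm]
        _ ≤ ENNReal.ofReal η := ENNReal.ofReal_le_ofReal (hK₀ K h)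
  · rw [add_comm R η, ENNReal.ofReal_add hη.le (by linarith)]
    refine add_le_add (ENNReal.ofReal_le_ofReal ?_) ?_
    · rw [div_le_iff₀ hη] at hL₂
      calc V⁻¹ * ∑ j ∈ Finset.range K, w j ≤ V⁻¹ * ∑ j ∈ Finset.range K₀, w j :=
            mul_le_mul_of_nonneg_left (hWmono h) (by positivity)
        _ ≤ V⁻¹ * (V * η) := by gcongr
        _ = η := by field_simp
    · refine le_trans ?_ (hGR _ hψ)
      gcongr with j
      exact hanti (Nat.le_add_right _ _)

/-- `g(w,p)` contains, for every `n`, almost isometric copies of `ℓ_∞ⁿ` spanned by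
blocks `x 0, …, x (n - 1)`. -/
lemma exists_blocks_s8 {p : ℝ} (hp : 1 ≤ p) {w : ℕ → ℝ} (hw : IsGarlingWeight w) (n : ℕ) :
    ∀ R : ℝ, 1 < R → ∃ x : ℕ → ℕ → ℝ,
      (∀ i < n, ∃ φ : ℕ → ℕ, StrictMono φ ∧ 1 ≤ ∑' j, ENNReal.ofReal (|x i (φ j)| ^ p * w j)) ∧
      ∑' j, ENNReal.ofReal ((∑ i ∈ Finset.range n, |x i j|) ^ p) ≠ ⊤ ∧
      ∀ φ : ℕ → ℕ, StrictMono φ →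
        ∑' j, ENNReal.ofReal ((∑ i ∈ Finset.range n, |x i (φ j)|) ^ p * w j)
          ≤ ENNReal.ofReal R := by
  have hp₀ : p ≠ 0 := by linarith
  induction n with
  | zero => exact fun R _ => ⟨0, by simp [Real.zero_rpow hp₀]⟩
  | succ n ih =>
    intro R hR
    obtain ⟨x, hx₁, hx₂, hx₃⟩ := ih ((1 + R) / 2) (by linarith)
    have hnn : ∀ j, 0 ≤ (∑ i ∈ Finset.range n, |x i j|) ^ p := fun j => by positivity
    obtain ⟨L, t, ht, htL, hL⟩ := exists_flat_block hw hx₂ (R := (1 + R) / 2)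
      (η := (R - 1) / 2) (by linarith) (by linarith) (fun φ hφ => by
        simpa only [ENNReal.ofReal_mul (hnn _)] using hx₃ φ hφ)
    obtain ⟨a, ha, hap⟩ : ∃ a : ℝ, 0 ≤ a ∧ a ^ p = t :=
      ⟨t ^ p⁻¹, by positivity, Real.rpow_inv_rpow ht.le hp₀⟩
    set y : ℕ → ℕ → ℝ := fun i j =>
      if i < n then (if j < L then 0 else x i (j - L)) else (if j < L then a else 0)
      with hy
    have hsum : ∀ j, ENNReal.ofReal ((∑ i ∈ Finset.range (n + 1), |y i j|) ^ p)
        = if j < L then ENNReal.ofReal t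
          else ENNReal.ofReal ((∑ i ∈ Finset.range n, |x i (j - L)|) ^ p) := by
      intro j
      have hn : ∑ i ∈ Finset.range n, |y i j|
          = ∑ i ∈ Finset.range n, |if j < L then 0 else x i (j - L)| :=
        Finset.sum_congr rfl fun i hi => by simp only [hy, if_pos (Finset.mem_range.1 hi)]
      rw [Finset.sum_range_succ, hn]
      split_ifs with hj <;> simp [hy, hj, hap, abs_of_nonneg ha]
    refine ⟨y, fun i hi => ?_, ?_, fun φ hφ => ?_⟩
    · rcases Nat.lt_succ_iff_lt_or_eq.1 hi with hi | rfl
      · obtain ⟨φ, hφ, h⟩ := hx₁ i hi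
        exact ⟨fun j => φ j + L, fun a b hab => Nat.add_lt_add_right (hφ hab) L, by
          simpa [hy, hi] using h⟩
      · refine ⟨id, strictMono_id, le_trans ?_ (ENNReal.sum_le_tsum (Finset.range L))⟩
        have : ∀ j ∈ Finset.range L, ENNReal.ofReal (|y i (id j)| ^ p * w j)
            = ENNReal.ofReal (t * w j) := fun j hj => by
          simp [hy, Finset.mem_range.1 hj, abs_of_nonneg ha, hap]
        rw [Finset.sum_congr rfl this, ← ENNReal.ofReal_sum_of_nonneg
          (fun j _ => mul_nonneg ht.le (hw.2.1 j).le), ← Finset.mul_sum, htL]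
        simp
    · rw [tsum_congr hsum, ← ENNReal.summable.sum_add_tsum_nat_add' (k := L)]
      refine ENNReal.add_ne_top.2 ⟨ENNReal.sum_ne_top.2 fun j hj => ?_, ?_⟩
      · simp [Finset.mem_range.1 hj]
      · simpa using hx₂
    · have hnn' : ∀ j, 0 ≤ (∑ i ∈ Finset.range (n + 1), |y i j|) ^ p := fun j => by positivity
      simp only [ENNReal.ofReal_mul (hnn' _), hsum]
      convert hL φ hφ using 2
      ring

lemma garlingNorm_le_two {p : ℝ} (hp : 1 ≤ p) {w : ℕ → ℝ} (hw : ∀ n, 0 < w n) {f F : ℕ → ℝ}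
    (hfF : ∀ j, |f j| ≤ F j)
    (hF : ∀ φ : ℕ → ℕ, StrictMono φ → ∑' j, ENNReal.ofReal (F (φ j) ^ p * w j) ≤ 2) :
    garlingNorm p w f ≤ 2 := by
  refine iSup_le fun φ => ?_
  calc (∑' j, ENNReal.ofReal (|f (φ.1 j)| ^ p * w j)) ^ (1 / p)
      ≤ (2 : ℝ≥0∞) ^ (1 / p) := by
        refine ENNReal.rpow_le_rpow (le_trans ?_ (hF φ.1 φ.2)) (by positivity)
        refine ENNReal.tsum_le_tsum fun j => ENNReal.ofReal_le_ofReal ?_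
        exact mul_le_mul_of_nonneg_right
          (Real.rpow_le_rpow (abs_nonneg _) (hfF _) (by linarith)) (hw j).le
    _ ≤ (2 : ℝ≥0∞) ^ (1 : ℝ) := by
        refine ENNReal.rpow_le_rpow_of_exponent_le (by norm_num) ?_
        rw [div_le_one (by linarith)]
        exact hp
    _ = 2 := ENNReal.rpow_one 2

lemma one_le_garlingNorm {p : ℝ} (hp : 1 ≤ p) {w f : ℕ → ℝ} {φ : ℕ → ℕ} (hφ : StrictMono φ)
    (h : 1 ≤ ∑' j, ENNReal.ofReal (|f (φ j)| ^ p * w j)) : 1 ≤ garlingNorm p w f :=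
  (ENNReal.one_le_rpow h (by positivity)).trans
    (le_iSup (fun φ : {φ : ℕ → ℕ // StrictMono φ} =>
      (∑' j : ℕ, ENNReal.ofReal (|f (φ.1 j)| ^ p * w j)) ^ (1 / p)) ⟨φ, hφ⟩)

lemma garlingNorm_smul_le {p : ℝ} (hp : 1 ≤ p) (w f : ℕ → ℝ) (a : ℝ) :
    garlingNorm p w (a • f) ≤ ENNReal.ofReal |a| * garlingNorm p w f := by
  have hp₀ : 0 < p := by linarith
  refine iSup_le fun φ => ?_
  have h : ∀ j, ENNReal.ofReal (|(a • f) (φ.1 j)| ^ p * w j)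
      = ENNReal.ofReal |a| ^ p * ENNReal.ofReal (|f (φ.1 j)| ^ p * w j) := fun j => by
    rw [Pi.smul_apply, smul_eq_mul, abs_mul, Real.mul_rpow (abs_nonneg _) (abs_nonneg _),
      mul_assoc, ENNReal.ofReal_mul (by positivity),
      ENNReal.ofReal_rpow_of_nonneg (abs_nonneg _) hp₀.le]
  rw [tsum_congr h, ENNReal.tsum_mul_left, ENNReal.mul_rpow_of_nonneg _ _ (by positivity),
    ← ENNReal.rpow_mul, mul_one_div_cancel hp₀.ne', ENNReal.rpow_one]
  gcongr
  exact le_iSup (fun φ : {φ : ℕ → ℕ // StrictMono φ} =>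
    (∑' j : ℕ, ENNReal.ofReal (|f (φ.1 j)| ^ p * w j)) ^ (1 / p)) φ

/-- **Theorem (non-superreflexivity).** `g(w,p)` admits no equivalent uniformly convex
norm: there is no function `N` on `g(w,p) = {f : ‖f‖_g < ∞}` satisfying the triangle
inequality and homogeneity, equivalent to `‖·‖_g` (i.e. `c‖f‖_g ≤ N f ≤ C‖f‖_g` with
`0 < c ≤ C`), and uniformly convex. -/
theorem garling_not_superreflexive (p : ℝ) (hp : 1 ≤ p) (w : ℕ → ℝ)
    (hw : IsGarlingWeight w) :
    ¬ ∃ (N : (ℕ → ℝ) → ℝ) (c C : ℝ), 0 < c ∧ c ≤ C ∧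
      (∀ f g : ℕ → ℝ, garlingNorm p w f < ⊤ → garlingNorm p w g < ⊤ →
        N (f + g) ≤ N f + N g) ∧
      (∀ f : ℕ → ℝ, garlingNorm p w f < ⊤ → ∀ a : ℝ, N (a • f) = |a| * N f) ∧
      (∀ f : ℕ → ℝ, garlingNorm p w f < ⊤ →
        c * (garlingNorm p w f).toReal ≤ N f ∧ N f ≤ C * (garlingNorm p w f).toReal) ∧
      (∀ ε : ℝ, 0 < ε → ∃ δ : ℝ, 0 < δ ∧
        ∀ f g : ℕ → ℝ, garlingNorm p w f < ⊤ → garlingNorm p w g < ⊤ →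
          N f ≤ 1 → N g ≤ 1 → ε ≤ N (f - g) →
            N ((1 / 2 : ℝ) • (f + g)) ≤ 1 - δ) := by
  rintro ⟨N, c, C, hc, hcC, -, hsmul, heq, huc⟩
  have hC : 0 < C := hc.trans_le hcC
  obtain ⟨δ₀, hδ₀, huc⟩ := huc (c / C) (by positivity)
  set δ : ℝ := min δ₀ (1 / 2)
  have hδ : 0 < δ := lt_min hδ₀ (by norm_num)
  have hδ' : δ ≤ 1 / 2 := min_le_right _ _
  obtain ⟨n, hn⟩ := exists_pow_lt_of_lt_one (show 0 < c / (2 * C) by positivity)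
    (show 1 - δ < 1 by linarith)
  obtain ⟨x, hx₁, -, hx₂⟩ := exists_blocks_s8 hp hw (n + 1) 2 one_lt_two
  have hfin : ∀ k ≤ n + 1, ∀ f : ℕ → ℝ, (∀ j, |f j| ≤ ∑ i ∈ Finset.range k, |x i j|) →
      garlingNorm p w f ≤ 2 := fun k hk f hf =>
    garlingNorm_le_two hp hw.2.1 (fun j => (hf j).trans
      (Finset.sum_le_sum_of_subset_of_nonneg (Finset.range_mono hk) fun _ _ _ => abs_nonneg _))
      (by simpa using hx₂)
  have hx : ∀ k < n + 1, garlingNorm p w (x k) ≤ 2 := fun k hk =>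
    hfin (k + 1) hk (x k) fun j =>
      Finset.single_le_sum (f := fun i => |x i j|) (fun _ _ => abs_nonneg _)
        (Finset.self_mem_range_succ k)
  have hlow : ∀ k < n + 1, c ≤ N (x k) := fun k hk => by
    have hlt : garlingNorm p w (x k) < ⊤ := (hx k hk).trans_lt (by simp)
    obtain ⟨φ, hφ, h⟩ := hx₁ k hk
    have h₁ : 1 ≤ (garlingNorm p w (x k)).toReal := by
      simpa using ENNReal.toReal_mono hlt.ne (one_le_garlingNorm hp hφ h)
    exact (le_mul_of_one_le_right hc.le h₁).trans (heq _ hlt).1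
  have key : ∀ m k : ℕ, k + m = n + 1 → ∀ f : ℕ → ℝ,
      (∀ j, |f j| ≤ ∑ i ∈ Finset.range k, |x i j|) → N f ≤ 2 * C * (1 - δ) ^ m := by
    intro m
    induction m with
    | zero =>
      intro k hk f hf
      have h2 := hfin k (by omega) f hf
      have h3 : (garlingNorm p w f).toReal ≤ 2 := by
        simpa using ENNReal.toReal_mono (by simp) h2
      have := (heq f (h2.trans_lt (by simp))).2
      nlinarith
    | succ m ih =>
      intro k hk f hf
      set b : ℝ := 2 * C * (1 - δ) ^ m with hb
      have hbpos : 0 < b := by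
        have : 0 < 1 - δ := by linarith
        positivity
      have hbC : b ≤ 2 * C :=
        mul_le_of_le_one_right (by positivity) (pow_le_one₀ (by linarith) (by linarith))
      have hadd : ∀ j, |(f + x k) j| ≤ ∑ i ∈ Finset.range (k + 1), |x i j| := fun j => by
        rw [Finset.sum_range_succ]
        exact (abs_add_le _ _).trans (add_le_add_left (hf j) _)
      have hsub : ∀ j, |(f - x k) j| ≤ ∑ i ∈ Finset.range (k + 1), |x i j| := fun j => by
        rw [Finset.sum_range_succ]
        exact (abs_sub _ _).trans (add_le_add_left (hf j) _)
      have hlt : ∀ g : ℕ → ℝ, garlingNorm p w g ≤ 2 → garlingNorm p w g < ⊤ :=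
        fun g hg => hg.trans_lt (by simp)
      have hscale : ∀ g : ℕ → ℝ, garlingNorm p w g < ⊤ → N (b⁻¹ • g) = b⁻¹ * N g :=
        fun g hg => by rw [hsmul g hg, abs_of_pos (inv_pos.2 hbpos)]
      have hscale_lt : ∀ g : ℕ → ℝ, garlingNorm p w g < ⊤ → garlingNorm p w (b⁻¹ • g) < ⊤ :=
        fun g hg => (garlingNorm_smul_le hp w g _).trans_lt
          (ENNReal.mul_lt_top ENNReal.ofReal_lt_top hg)
      have hf_lt := hlt f (hfin k (by omega) f hf)
      have hx_lt := hlt (x k) (hx k (by omega))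
      have hadd_lt := hlt _ (hfin (k + 1) (by omega) _ hadd)
      have hsub_lt := hlt _ (hfin (k + 1) (by omega) _ hsub)
      have hmid : (1 / 2 : ℝ) • (b⁻¹ • (f + x k) + b⁻¹ • (f - x k)) = b⁻¹ • f := by
        ext j
        simp only [Pi.smul_apply, Pi.add_apply, Pi.sub_apply, smul_eq_mul]
        ring
      have hdiff : b⁻¹ • (f + x k) - b⁻¹ • (f - x k) = (b⁻¹ * 2) • x k := by
        ext j
        simp only [Pi.smul_apply, Pi.add_apply, Pi.sub_apply, smul_eq_mul]
        ring
      have hunit : ∀ g : ℕ → ℝ, garlingNorm p w g < ⊤ → N g ≤ b → N (b⁻¹ • g) ≤ 1 :=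
        fun g hg hgb => by
          rw [hscale g hg, inv_mul_le_iff₀ hbpos, mul_one]
          exact hgb
      have huc' := huc _ _ (hscale_lt _ hadd_lt) (hscale_lt _ hsub_lt)
        (hunit _ hadd_lt (ih (k + 1) (by omega) _ hadd))
        (hunit _ hsub_lt (ih (k + 1) (by omega) _ hsub)) (by
          rw [hdiff, hsmul _ hx_lt, abs_of_pos (by positivity)]
          calc c / C = (2 * C)⁻¹ * 2 * c := by field_simp
            _ ≤ b⁻¹ * 2 * N (x k) := by
              have := hlow k (by omega)
              gcongr)
      rw [hmid, hscale f hf_lt, inv_mul_le_iff₀ hbpos] at huc'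
      calc N f ≤ b * (1 - δ₀) := huc'
        _ ≤ b * (1 - δ) := by
          have : δ ≤ δ₀ := min_le_left _ _
          gcongr
        _ = 2 * C * (1 - δ) ^ (m + 1) := by rw [hb]; ring
  have h := key n 1 (by omega) (x 0) (by simp)
  have h' := hlow 0 (by omega)
  rw [lt_div_iff₀ (by positivity)] at hn
  linarith

end
end
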